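/- arXiv:2211.16005 — 3 statements merged into one kernel-verified Lean document; each statement's English description precedes it below -/
import Mathlib

section
/- Let d_j, d_q, d_r ∈ ℝ³ be unit vectors and let A ∈ ℝ^{3×3} be the Gram matrix of the three vectors d_j × d_q, d_q × d_r, d_r × d_j (i.e., A_{ab} is the inner product of the a-th and b-th of these vectors). Then A is symmetric positive semidefinite, and for all δ_j, δ_q, δ_r ∈ ℝ, four times the squared area of the triangle with vertices δ_j·d_j, δ_q·d_q, δ_r·d_r equals uᵀ A u, where u = (δ_jδ_q, δ_qδ_r, δ_rδ_j) ∈ ℝ³. Hence the squared area is a linear function of the entries of the rank-one matrix u uᵀ. -/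
open scoped RealInnerProductSpace

noncomputable section

/-- The cross product on `ℝ³` (Euclidean space). -/
def cross3 (a b : EuclideanSpace ℝ (Fin 3)) : EuclideanSpace ℝ (Fin 3) :=
  (WithLp.equiv 2 (Fin 3 → ℝ)).symm
    (crossProduct ((WithLp.equiv 2 (Fin 3 → ℝ)) a) ((WithLp.equiv 2 (Fin 3 → ℝ)) b))

/-- The area of the triangle with vertices `a`, `b`, `c` in `ℝ³`. -/
def triangleArea (a b c : EuclideanSpace ℝ (Fin 3)) : ℝ :=
  (1 / 2) * ‖cross3 (b - a) (c - a)‖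

theorem cross3_sub_sub (a b c : EuclideanSpace ℝ (Fin 3)) :
    cross3 (b - a) (c - a) = cross3 a b + cross3 b c + cross3 c a := by
  ext i
  fin_cases i <;> simp [cross3, cross_apply] <;> ring

theorem cross3_smul_smul (s t : ℝ) (a b : EuclideanSpace ℝ (Fin 3)) :
    cross3 (s • a) (t • b) = (s * t) • cross3 a b := by
  simp [cross3, smul_smul, mul_comm]

theorem four_mul_triangleArea_sq (a b c : EuclideanSpace ℝ (Fin 3)) :
    4 * triangleArea a b c ^ 2 = ‖cross3 a b + cross3 b c + cross3 c a‖ ^ 2 := by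
  rw [triangleArea, cross3_sub_sub]
  ring

open Matrix in
theorem dotProduct_gram_mulVec {ι E : Type*} [Fintype ι] [NormedAddCommGroup E]
    [InnerProductSpace ℝ E] (w : ι → E) (x : ι → ℝ) :
    x ⬝ᵥ (gram ℝ w) *ᵥ x = ‖∑ i, x i • w i‖ ^ 2 := by
  simpa using star_dotProduct_gram_mulVec (𝕜 := ℝ) (v := w) x x

open Matrix in
/-- the Gram matrix `A` of the vectors `d_j×d_q`, `d_q×d_r`, `d_r×d_j`
is symmetric positive semidefinite, and four times the squared triangle area equals
`uᵀ A u` with `u = (δ_jδ_q, δ_qδ_r, δ_rδ_j)`. -/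
theorem sq_area_eq_quadratic_form_gram (dj dq dr : EuclideanSpace ℝ (Fin 3))
    (hj : ‖dj‖ = 1) (hq : ‖dq‖ = 1) (hr : ‖dr‖ = 1)
    (w : Fin 3 → EuclideanSpace ℝ (Fin 3))
    (hw : w = ![cross3 dj dq, cross3 dq dr, cross3 dr dj])
    (A : Matrix (Fin 3) (Fin 3) ℝ)
    (hA : ∀ a b : Fin 3, A a b = ⟪w a, w b⟫) :
    A.IsSymm ∧
    (∀ x : Fin 3 → ℝ, 0 ≤ x ⬝ᵥ A.mulVec x) ∧
    (∀ δj δq δr : ℝ,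
      4 * (triangleArea (δj • dj) (δq • dq) (δr • dr)) ^ 2 =
        ![δj * δq, δq * δr, δr * δj] ⬝ᵥ A.mulVec ![δj * δq, δq * δr, δr * δj]) := by
  obtain rfl : A = gram ℝ w := Matrix.ext hA
  refine ⟨?_, fun x => ?_, fun δj δq δr => ?_⟩
  · simpa [IsSymm, IsHermitian] using isHermitian_gram ℝ w
  · rw [dotProduct_gram_mulVec]
    positivity
  · rw [four_mul_triangleArea_sq, dotProduct_gram_mulVec, hw]
    simp [Fin.sum_univ_three, cross3_smul_smul]

end
end

section
/- Define ϑ : ℝ³ × ℝ³ → ℝ⁶ by ϑ(P, Q) = (P_x Q_y, P_x Q_z, P_y Q_x, P_y Q_z, P_z Q_x, P_z Q_y). There exists a linear map L : ℝ¹⁸ → ℝ³, independent of the points, such that for all P_j, P_q, P_r ∈ ℝ³, four times the squared area of the triangle with vertices P_j, P_q, P_r equals ‖L(ϑ(P_j, P_q), ϑ(P_q, P_r), ϑ(P_r, P_j))‖². Hence the squared area is a linear function of the entries of v vᵀ, where v ∈ ℝ¹⁸ is the concatenation (ϑ(P_j, P_q), ϑ(P_q, P_r), ϑ(P_r, P_j)).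 -/
open scoped RealInnerProductSpace

noncomputable section

/-- The map `ϑ(P,Q) = (PₓQ_y, PₓQ_z, P_yQₓ, P_yQ_z, P_zQₓ, P_zQ_y)`. -/
def theta (P Q : EuclideanSpace ℝ (Fin 3)) : Fin 6 → ℝ :=
  ![P 0 * Q 1, P 0 * Q 2, P 1 * Q 0, P 1 * Q 2, P 2 * Q 0, P 2 * Q 1]

/-- The linear map `ℝ⁶ → ℝ³` sending `ϑ(P, Q)` to `P × Q`. -/
def crossOfTheta : (Fin 6 → ℝ) →ₗ[ℝ] EuclideanSpace ℝ (Fin 3) where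
  toFun v := !₂[v 3 - v 5, v 4 - v 1, v 0 - v 2]
  map_add' u v := by
    ext i
    fin_cases i <;> simp <;> ring
  map_smul' c v := by
    ext i
    fin_cases i <;> simp <;> ring

theorem crossOfTheta_theta (P Q : EuclideanSpace ℝ (Fin 3)) :
    crossOfTheta (theta P Q) = cross3 P Q := by
  ext i
  fin_cases i <;> simp [crossOfTheta, theta, cross3, cross_apply]

/-- The linear map `ℝ¹⁸ → ℝ³` applying `crossOfTheta` to the three blocks and adding up. -/
def crossSumOfTheta : (Fin 18 → ℝ) →ₗ[ℝ] EuclideanSpace ℝ (Fin 3) :=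
  crossOfTheta ∘ₗ
    (LinearMap.funLeft ℝ ℝ (fun i : Fin 6 => Fin.castAdd 6 (Fin.castAdd 6 i)) +
      LinearMap.funLeft ℝ ℝ (fun i : Fin 6 => Fin.castAdd 6 (Fin.natAdd 6 i)) +
      LinearMap.funLeft ℝ ℝ (fun i : Fin 6 => Fin.natAdd 12 i))

theorem crossSumOfTheta_append (u v w : Fin 6 → ℝ) :
    crossSumOfTheta (Fin.append (Fin.append u v) w) =
      crossOfTheta u + crossOfTheta v + crossOfTheta w := by
  rw [← map_add, ← map_add]
  refine congrArg crossOfTheta (funext fun i => ?_)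
  exact congrArg₂ (· + ·)
    (congrArg₂ (· + ·)
      ((Fin.append_left _ w _).trans (Fin.append_left u v i))
      ((Fin.append_left _ w _).trans (Fin.append_right u v i)))
    (Fin.append_right (Fin.append u v) w i)

/-- there is a fixed linear map `L : ℝ¹⁸ → ℝ³` such that four times the
squared area of the triangle `(P_j, P_q, P_r)` equals
`‖L(ϑ(P_j,P_q), ϑ(P_q,P_r), ϑ(P_r,P_j))‖²`. -/
theorem sq_area_linear_in_theta :
    ∃ L : (Fin 18 → ℝ) →ₗ[ℝ] EuclideanSpace ℝ (Fin 3),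
      ∀ Pj Pq Pr : EuclideanSpace ℝ (Fin 3),
        4 * (triangleArea Pj Pq Pr) ^ 2 =
          ‖L (Fin.append (Fin.append (theta Pj Pq) (theta Pq Pr)) (theta Pr Pj))‖ ^ 2 := by
  refine ⟨crossSumOfTheta, fun Pj Pq Pr => ?_⟩
  rw [crossSumOfTheta_append, crossOfTheta_theta, crossOfTheta_theta, crossOfTheta_theta,
    ← cross3_sub_sub, triangleArea]
  ring

end
end

section
/- Let d₁, …, d_m ∈ ℝ³ be unit vectors and E a set of index pairs such that every index in {1, …, m} belongs to at least one pair of E, and such that d_j and d_q are linearly independent for every (j, q) ∈ E. Then for every ε > 0, the set {δ ∈ [0, ∞)^m : ‖δ_j·d_j − δ_q·d_q‖ ≤ ε for all (j,q) ∈ E} is bounded. -/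
/-- The coefficients of a linear combination of two linearly independent vectors are controlled
by its norm. -/
theorem LinearIndependent.exists_abs_le_mul_norm_sub {V : Type*} [NormedAddCommGroup V]
    [NormedSpace ℝ V] {u v : V} (h : LinearIndependent ℝ ![u, v]) :
    ∃ C : ℝ, 0 ≤ C ∧ ∀ a b : ℝ, |a| ≤ C * ‖a • u - b • v‖ ∧ |b| ≤ C * ‖a • u - b • v‖ := by
  obtain ⟨K, -, hK⟩ := (Fintype.linearCombination ℝ ![u, v]).exists_antilipschitzWith
    (LinearMap.ker_eq_bot.2 (LinearIndependent.fintypeLinearCombination_injective h))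
  refine ⟨K, K.2, fun a b => ?_⟩
  have key := hK.le_mul_dist ![a, -b] 0
  rw [map_zero, dist_zero_right, dist_zero_right, Fintype.linearCombination_apply,
    Fin.sum_univ_two] at key
  simp only [Matrix.cons_val_zero, Matrix.cons_val_one, neg_smul, ← sub_eq_add_neg] at key
  have h0 := (norm_le_pi_norm ![a, -b] 0).trans key
  have h1 := (norm_le_pi_norm ![a, -b] 1).trans key
  exact ⟨by simpa using h0, by simpa using h1⟩

/-- if every index is covered by some edge and the two sightline
directions of each edge are linearly independent, then the set of nonnegative depth
vectors whose edge lengths are all at most `ε` is bounded. -/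
theorem quasi_isometric_solution_space_bounded (m : ℕ)
    (d : Fin m → EuclideanSpace ℝ (Fin 3)) (hd : ∀ i, ‖d i‖ = 1)
    (E : Set (Fin m × Fin m))
    (hcover : ∀ i : Fin m, ∃ p ∈ E, p.1 = i ∨ p.2 = i)
    (hindep : ∀ p ∈ E, LinearIndependent ℝ ![d p.1, d p.2]) :
    ∀ ε : ℝ, 0 < ε →
      Bornology.IsBounded {δ : Fin m → ℝ | (∀ i, 0 ≤ δ i) ∧
        ∀ p ∈ E, ‖δ p.1 • d p.1 - δ p.2 • d p.2‖ ≤ ε} := by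
  intro ε _
  choose p hpE hpi using hcover
  choose C hC0 hC using fun i => (hindep (p i) (hpE i)).exists_abs_le_mul_norm_sub
  refine (Metric.isBounded_Icc (0 : Fin m → ℝ) fun i => C i * ε).subset ?_
  rintro δ ⟨hδ0, hδ⟩
  refine ⟨hδ0, fun i => ?_⟩
  have hle := mul_le_mul_of_nonneg_left (hδ (p i) (hpE i)) (hC0 i)
  obtain ⟨h1, h2⟩ := hC i (δ (p i).1) (δ (p i).2)
  refine (le_abs_self _).trans ?_
  rcases hpi i with h | h
  · rw [h] at h1 hle
    exact h1.trans hle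
  · rw [h] at h2 hle
    exact h2.trans hle
end
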